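/- arXiv:1612.04704 — 4 statements merged into one kernel-verified Lean document; each statement's English description precedes it below -/
import Mathlib

section
/- Let E be the Euclidean plane ℝ², let cᵢ, cⱼ ∈ E and let rᵢ > 0, rⱼ > 0. Then the guaranteed dominance set {q ∈ E : dist(q,pᵢ) ≤ dist(q,pⱼ) for all pᵢ ∈ B̄(cᵢ,rᵢ) and all pⱼ ∈ B̄(cⱼ,rⱼ)} equals the guaranteed dominance region H_{ij} := {q ∈ E : dist(q,cᵢ) + rᵢ + rⱼ ≤ dist(q,cⱼ)}. -/
lemma exists_unit_dir (v : EuclideanSpace ℝ (Fin 2)) :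
    ∃ u : EuclideanSpace ℝ (Fin 2), ‖u‖ = 1 ∧ v = ‖v‖ • u := by
  by_cases h : v = 0
  · obtain ⟨u, hu⟩ := exists_norm_eq (EuclideanSpace ℝ (Fin 2)) (zero_le_one (α := ℝ))
    exact ⟨u, hu, by simp [h]⟩
  · have hv : ‖v‖ ≠ 0 := norm_ne_zero_iff.mpr h
    refine ⟨‖v‖⁻¹ • v, ?_, ?_⟩
    · rw [norm_smul, norm_inv, norm_norm, inv_mul_cancel₀ hv]
    · rw [smul_smul, mul_inv_cancel₀ hv, one_smul]

lemma exists_dist_shift (q c : EuclideanSpace ℝ (Fin 2)) (t : ℝ) :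
    ∃ p : EuclideanSpace ℝ (Fin 2), dist p c = |t| ∧ dist q p = |dist q c + t| := by
  obtain ⟨u, hu, hv⟩ := exists_unit_dir (q - c)
  refine ⟨c - t • u, ?_, ?_⟩
  · rw [dist_eq_norm]
    simp [norm_smul, hu]
  · have h : q - (c - t • u) = (‖q - c‖ + t) • u := by
      rw [add_smul, ← hv]
      abel
    rw [dist_eq_norm, dist_eq_norm, h, norm_smul, hu, mul_one, Real.norm_eq_abs]

/-- The set of points guaranteed to be closer to node `i` than to node `j`, for all
possible positions of the nodes inside their uncertainty disks, equals the guaranteed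
dominance region `H_{ij} = {q : dist q cᵢ + rᵢ + rⱼ ≤ dist q cⱼ}`. -/
theorem guaranteed_dominance_eq (ci cj : EuclideanSpace ℝ (Fin 2)) (ri rj : ℝ)
    (hri : 0 < ri) (hrj : 0 < rj) :
    {q : EuclideanSpace ℝ (Fin 2) |
        ∀ pi ∈ Metric.closedBall ci ri, ∀ pj ∈ Metric.closedBall cj rj, dist q pi ≤ dist q pj}
      = {q : EuclideanSpace ℝ (Fin 2) | dist q ci + ri + rj ≤ dist q cj} := by
  ext q
  simp only [Set.mem_setOf_eq, Metric.mem_closedBall]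
  constructor
  · intro h
    have hd : 0 ≤ dist q ci := dist_nonneg
    obtain ⟨a, ha, hqa⟩ := exists_dist_shift q ci ri
    rw [abs_of_pos hri] at ha
    rw [abs_of_nonneg (by linarith)] at hqa
    rcases le_total (dist q cj) rj with hj | hj
    · have := h a ha.le q hj
      rw [dist_self] at this
      linarith
    · obtain ⟨b, hb, hqb⟩ := exists_dist_shift q cj (-rj)
      rw [abs_neg, abs_of_pos hrj] at hb
      rw [abs_of_nonneg (by linarith)] at hqb
      have := h a ha.le b hb.le
      linarith
  · intro h a ha b hb
    have h1 := dist_triangle q ci a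
    have h2 := dist_triangle q b cj
    rw [dist_comm ci a] at h1
    linarith
end

section
/- Let E be the Euclidean plane ℝ², let a, b ∈ E and let k ≥ 0. Then the set {q ∈ E : dist(q,a) + k ≤ dist(q,b)} is convex. (This is the region bounded by one branch of a hyperbola with foci a, b that contains the focus a.) -/
/-- The region `{q : dist q a + k ≤ dist q b}` (bounded by one branch of a hyperbola
with foci `a`, `b`) is convex for `k ≥ 0`. -/
theorem guaranteed_dominance_convex (a b : EuclideanSpace ℝ (Fin 2)) (k : ℝ) (hk : 0 ≤ k) :
    Convex ℝ {q : EuclideanSpace ℝ (Fin 2) | dist q a + k ≤ dist q b} := by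
  have key : ∀ q : EuclideanSpace ℝ (Fin 2), dist q a + k ≤ dist q b ↔
      2 * k * dist q a + k ^ 2 ≤ 2 * inner ℝ q (a - b) + ‖b‖ ^ 2 - ‖a‖ ^ 2 := by
    intro q
    have h1 : dist q a ^ 2 = ‖q‖ ^ 2 - 2 * inner ℝ q a + ‖a‖ ^ 2 := by
      rw [dist_eq_norm, norm_sub_sq_real]
    have h2 : dist q b ^ 2 = ‖q‖ ^ 2 - 2 * inner ℝ q b + ‖b‖ ^ 2 := by
      rw [dist_eq_norm, norm_sub_sq_real]
    have h3 : (0 : ℝ) ≤ dist q a + k := add_nonneg dist_nonneg hk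
    rw [← sq_le_sq₀ h3 dist_nonneg, inner_sub_right]
    constructor <;> intro h <;> nlinarith
  intro x hx y hy s t hs ht hst
  simp only [Set.mem_setOf_eq] at hx hy ⊢
  rw [key] at hx hy ⊢
  have hd : dist (s • x + t • y) a ≤ s * dist x a + t * dist y a := by
    have h := (convexOn_dist a (convex_univ (𝕜 := ℝ))).2 (Set.mem_univ x) (Set.mem_univ y) hs ht hst
    simpa using h
  rw [inner_add_left, real_inner_smul_left, real_inner_smul_left]
  have e1 := mul_le_mul_of_nonneg_left hx hs
  have e2 := mul_le_mul_of_nonneg_left hy ht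
  have e3 := mul_le_mul_of_nonneg_left hd (by positivity : 0 ≤ 2 * k)
  obtain rfl : t = 1 - s := by linarith
  linarith
end

section
/- Let E be the Euclidean plane ℝ², let Ω ⊆ E be convex, let I be a finite index set, let (cᵢ)_{i∈I} be points of E and (rᵢ)_{i∈I} nonnegative reals. Then for every i ∈ I the guaranteed Voronoi cell Vᵢᵍ = Ω ∩ ⋂_{j ∈ I, j ≠ i} {q : dist(q,cᵢ) + rᵢ + rⱼ ≤ dist(q,cⱼ)} is a convex set. -/
lemma gv_halfplane_iff (a b q : EuclideanSpace ℝ (Fin 2)) (s : ℝ) (hs : 0 ≤ s) :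
    dist q a + s ≤ dist q b ↔
      2 * s * dist q a + s ^ 2 + (2 * inner ℝ q (b - a) + ‖a‖ ^ 2 - ‖b‖ ^ 2) ≤ 0 := by
  have h1 : dist q a ^ 2 = ‖q‖ ^ 2 - 2 * inner ℝ q a + ‖a‖ ^ 2 := by
    rw [dist_eq_norm, norm_sub_sq_real]
  have h2 : dist q b ^ 2 = ‖q‖ ^ 2 - 2 * inner ℝ q b + ‖b‖ ^ 2 := by
    rw [dist_eq_norm, norm_sub_sq_real]
  have h3 : 0 ≤ dist q a + s := add_nonneg dist_nonneg hs
  rw [← sq_le_sq₀ h3 dist_nonneg, h2, add_sq, h1, inner_sub_right]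
  constructor <;> intro h <;> linarith

lemma gv_dominance_convex (a b : EuclideanSpace ℝ (Fin 2)) (s : ℝ) (hs : 0 ≤ s) :
    Convex ℝ {q : EuclideanSpace ℝ (Fin 2) | dist q a + s ≤ dist q b} := by
  intro x hx y hy t u ht hu htu
  rw [Set.mem_setOf_eq, gv_halfplane_iff a b _ s hs] at *
  have hd : dist (t • x + u • y) a ≤ t * dist x a + u * dist y a := by
    simpa using (convexOn_dist a convex_univ).2 (Set.mem_univ x) (Set.mem_univ y) ht hu htu
  have hd' := mul_le_mul_of_nonneg_left hd hs
  have h1 := mul_le_mul_of_nonneg_left hx ht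
  have h2 := mul_le_mul_of_nonneg_left hy hu
  rw [inner_add_left, real_inner_smul_left, real_inner_smul_left]
  obtain rfl : u = 1 - t := by linarith
  linarith

/-- The guaranteed Voronoi cell of node `i`, restricted to a convex region `Ω`,
is a convex set. -/
theorem gv_cell_convex {I : Type*} [Fintype I]
    (Ω : Set (EuclideanSpace ℝ (Fin 2))) (hΩ : Convex ℝ Ω)
    (c : I → EuclideanSpace ℝ (Fin 2)) (r : I → ℝ) (hr : ∀ i, 0 ≤ r i) (i : I) :
    Convex ℝ (Ω ∩ ⋂ (j : I) (_ : j ≠ i),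
      {q : EuclideanSpace ℝ (Fin 2) | dist q (c i) + r i + r j ≤ dist q (c j)}) := by
  refine hΩ.inter (convex_iInter₂ fun j _ => ?_)
  simpa only [add_assoc] using
    gv_dominance_convex (c i) (c j) (r i + r j) (add_nonneg (hr i) (hr j))
end

section
/- Let E be the Euclidean plane ℝ², let a, b ∈ E with a ≠ b, and let k be a real number with 0 ≤ k ≤ dist(a,b). Then the topological frontier of the guaranteed dominance region {q ∈ E : dist(q,a) + k ≤ dist(q,b)} equals the equality set {q ∈ E : dist(q,a) + k = dist(q,b)}, i.e. the corresponding branch of the hyperbola with foci a and b and major axis k. -/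
/-- The topological frontier of the guaranteed dominance region
`{q : dist q a + k ≤ dist q b}` (for `a ≠ b` and `0 ≤ k ≤ dist a b`) is the
corresponding branch of the hyperbola with foci `a`, `b` and major axis `k`. -/
theorem frontier_guaranteed_dominance (a b : EuclideanSpace ℝ (Fin 2)) (k : ℝ)
    (hab : a ≠ b) (hk : 0 ≤ k) (hk' : k ≤ dist a b) :
    frontier {q : EuclideanSpace ℝ (Fin 2) | dist q a + k ≤ dist q b}
      = {q : EuclideanSpace ℝ (Fin 2) | dist q a + k = dist q b} := by
  apply Set.Subset.antisymm
  · exact frontier_le_subset_eq (by fun_prop) (by fun_prop)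
  intro q hq
  have hq : dist q a + k = dist q b := hq
  refine ⟨subset_closure (le_of_eq hq), fun hint => ?_⟩
  rcases hk'.lt_or_eq with hlt | heq
  · -- move towards `b`
    have hc : Filter.Tendsto (fun t : ℝ => q + t • (b - q)) (nhdsWithin 0 (Set.Ioi 0)) (nhds q) := by
      have : Continuous (fun t : ℝ => q + t • (b - q)) := by fun_prop
      have h := this.tendsto 0
      simp only [zero_smul, add_zero] at h
      exact h.mono_left nhdsWithin_le_nhds
    have h1 := hc.eventually (mem_interior_iff_mem_nhds.mp hint)
    have h2 : ∀ᶠ t : ℝ in nhdsWithin 0 (Set.Ioi 0), t ∈ Set.Ioo (0:ℝ) 1 :=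
      Ioo_mem_nhdsGT one_pos
    obtain ⟨t, ht, ht0, ht1⟩ := (h1.and h2).exists
    have ht : dist (q + t • (b - q)) a + k ≤ dist (q + t • (b - q)) b := ht
    have e1 : dist (q + t • (b - q)) b = (1 - t) * ‖b - q‖ := by
      rw [dist_eq_norm, show q + t • (b - q) - b = -((1 - t) • (b - q)) by module, norm_neg,
        norm_smul, Real.norm_of_nonneg (by linarith)]
    have e2 : dist (q + t • (b - q)) a = ‖(a - q) - t • (b - q)‖ := by
      rw [dist_comm, dist_eq_norm]; congr 1; module
    have e3 : ‖t • (b - q)‖ = t * ‖b - q‖ := by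
      rw [norm_smul, Real.norm_of_nonneg ht0.le]
    have e4 : ‖a - q‖ + k = ‖b - q‖ := by
      rw [← dist_eq_norm, ← dist_eq_norm, dist_comm a, dist_comm b]; exact hq
    have h3 := norm_add_le ((a - q) - t • (b - q)) (t • (b - q))
    have h4 : SameRay ℝ ((a - q) - t • (b - q)) (t • (b - q)) := by
      rw [sameRay_iff_norm_add]
      apply le_antisymm h3
      rw [sub_add_cancel, e3]
      rw [e1, e2] at ht
      linarith
    have h5 : SameRay ℝ (a - q) (t • (b - q)) := by
      have := h4.add_left (SameRay.refl (t • (b - q)))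
      rwa [sub_add_cancel] at this
    have h6 : SameRay ℝ (a - q) (b - q) := by
      have := h5.trans (SameRay.sameRay_pos_smul_left (b - q) ht0) (fun h => Or.inr ((smul_eq_zero.mp h).resolve_left ht0.ne'))
      exact this
    have h7 := h6.norm_sub
    rw [sub_sub_sub_cancel_right, ← dist_eq_norm, ← e4, abs_sub_comm, add_sub_cancel_left,
      abs_of_nonneg hk] at h7
    linarith
  · have hsub : interior {q : EuclideanSpace ℝ (Fin 2) | dist q a + k ≤ dist q b} ⊆
        (affineSpan ℝ {a, b} : Set (EuclideanSpace ℝ (Fin 2))) := by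
      intro p hp
      replace hp := interior_subset hp
      have hp : dist p a + k ≤ dist p b := hp
      have hw : Wbtw ℝ p a b := by
        rw [← dist_add_dist_eq_iff]
        exact le_antisymm (heq ▸ hp) (dist_triangle _ _ _)
      have : Collinear ℝ {p, a, b} := hw.collinear
      exact this.mem_affineSpan_of_mem_of_ne (by simp) (by simp) (by simp) hab
    have htop := isOpen_interior.affineSpan_eq_top ⟨q, hint⟩
    have h8 : affineSpan ℝ {a, b} = ⊤ := top_le_iff.mp (htop ▸ affineSpan_le.mpr hsub)
    have h9 := collinear_iff_finrank_le_one.mp (collinear_pair ℝ a b)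
    rw [← direction_affineSpan, h8, AffineSubspace.direction_top, finrank_top] at h9
    simp at h9
end
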